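/- arXiv:0906.4626 — 2 statements merged into one kernel-verified Lean document; each statement's English description precedes it below -/
import Mathlib

section
/- Let K/k be a real Artin-Schreier extension (the infinite place of k = F_q(t) splits completely in K), G = Gal(K/k) ≅ Z/pZ, U_K the unit group of the integral closure of F_q[t] in K. Then H^1(G, U_K) ≅ F_p. -/
set_option synthInstance.maxHeartbeats 1000000
set_option maxHeartbeats 4000000

section

open IsDedekindDomain

/-- If there are at least `[L : K]` primes of `B` above a nonzero prime of `A`, then all of them
have ramification index and inertia degree one. -/
theorem Ideal.ramificationIdx_inertiaDeg_eq_one_of_finrank_le_card {A B K L : Type*} [CommRing A]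
    [IsDedekindDomain A] [CommRing B] [IsDedekindDomain B] [Algebra A B] [Field K] [Field L]
    [Algebra A K] [IsFractionRing A K] [Algebra B L] [IsFractionRing B L] [Algebra K L]
    [Algebra A L] [IsScalarTower A B L] [IsScalarTower A K L] [Module.Finite A B]
    [Module.IsTorsionFree A B]
    {m : Ideal A} [m.IsMaximal] (hm : m ≠ ⊥) (Qs : Finset (Ideal B))
    (hcard : Module.finrank K L ≤ Qs.card) (hQs : ∀ Q ∈ Qs, Q.IsPrime ∧ Q.LiesOver m)
    {Q : Ideal B} (hQ : Q ∈ Qs) : m.ramificationIdx' Q = 1 ∧ m.inertiaDeg' Q = 1 := by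
  classical
  have hpos : ∀ P ∈ Qs, 1 ≤ m.ramificationIdx' P * m.inertiaDeg' P := fun P hP ↦ by
    have := (hQs P hP).1
    have := (hQs P hP).2
    exact Nat.mul_pos
      (IsDedekindDomain.ramificationIdx'_ne_zero_of_liesOver P hm).bot_lt (inertiaDeg'_pos m P)
  have hle : ∑ P ∈ Qs, m.ramificationIdx' P * m.inertiaDeg' P ≤ Qs.card := by
    refine le_trans (Finset.sum_le_sum_of_subset fun P hP ↦ ?_)
      ((sum_ramification_inertia B K L hm).le.trans hcard)
    exact (IsDedekindDomain.mem_primesOverFinset_iff hm B).2 (hQs P hP)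
  have hone : m.ramificationIdx' Q * m.inertiaDeg' Q = 1 := by
    refine ((Finset.sum_eq_sum_iff_of_le hpos).1 (le_antisymm ?_ ?_) Q hQ).symm
    · exact Finset.sum_le_sum hpos
    · simpa using hle
  exact ⟨Nat.eq_one_of_mul_eq_one_right hone, Nat.eq_one_of_mul_eq_one_left hone⟩


open WithZero in
theorem Valuation.Integers.isPrincipalIdealRing_of_surjective {A k : Type*} [CommRing A] [Field k]
    [Algebra A k] {ν : Valuation k ℤᵐ⁰} (hν : ν.Integers A) (hsurj : Function.Surjective ν) :
    IsPrincipalIdealRing A := by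
  have : MulArchimedean (MonoidHom.mrange ν) := inferInstance
  rw [hν.isPrincipalIdealRing_iff_not_denselyOrdered, hsurj.range_eq]
  intro h
  obtain ⟨⟨a, _⟩, h1, h2⟩ := h.dense ⟨exp (0 : ℤ), trivial⟩ ⟨exp (1 : ℤ), trivial⟩
    (by rw [← Subtype.coe_lt_coe, exp_lt_exp]; exact one_pos)
  rw [← Subtype.coe_lt_coe] at h1 h2
  have ha : a ≠ 0 := by rintro rfl; simp at h1
  rw [← exp_log ha] at h1 h2
  simp only [exp_lt_exp] at h1 h2
  omega

open WithZero in
/-- If a finite separable extension `K` of a discretely valued field `(k, ν)` has `[K : k]` places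
above `ν`, then `ν` extends to a valuation of `K` with the same value group and residue field. -/
theorem Valuation.Integers.exists_extension_of_splits {F A k K : Type*} [Field F] [Finite F]
    [Field k] [Algebra F k] [Field K] [Algebra k K] [FiniteDimensional k K]
    [Algebra.IsSeparable k K] [CommRing A] [Algebra A k] [Algebra A K] [IsScalarTower A k K]
    {B : Type*} [CommRing B] [Algebra A B] [Algebra B K] [IsScalarTower A B K]
    [IsIntegralClosure B A K] {ν : Valuation k ℤᵐ⁰} (hν : ν.Integers A)
    (hsurj : Function.Surjective ν)
    (hres : ∀ x, ν x ≤ 1 → ∃ c : F, ν (x - algebraMap F k c) < 1)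
    (hF : ∀ c, ν (algebraMap F k c) ≤ 1)
    (Qs : Finset (Ideal B))
    (hcard : Qs.card = Module.finrank k K) (hQs : ∀ Q ∈ Qs, Q.IsMaximal) :
    ∃ w : Valuation K ℤᵐ⁰, (∀ r, w (algebraMap k K r) = ν r) ∧
      ∀ n : ℕ, ∃ π : B → Fin (Nat.card F ^ n),
        ∀ x y, π x = π y → w (algebraMap B K x - algebraMap B K y) ≤ exp (-(n : ℤ)) := by
  have : IsDomain A := hν.hom_inj.isDomain
  have : IsPrincipalIdealRing A := hν.isPrincipalIdealRing_of_surjective hsurj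
  have : ValuationRing A := ValuationRing.of_integers ν hν
  have : IsFractionRing A k := hν.isFractionRing
  have hinj : Function.Injective (algebraMap B K) := IsIntegralClosure.algebraMap_injective B A K
  have : IsDomain B := hinj.isDomain
  have : IsDedekindDomain B := IsIntegralClosure.isDedekindDomain A k K B
  have : IsFractionRing B K := IsIntegralClosure.isFractionRing_of_finite_extension A k K B
  have : Algebra.IsIntegral A B := IsIntegralClosure.isIntegral_algebra A K
  have : Module.Finite A B := IsIntegralClosure.finite A k K B
  have : Module.IsTorsionFree A K := Module.IsTorsionFree.trans_faithfulSMul A k K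
  have : Module.IsTorsionFree A B := Module.isTorsionFree_iff_algebraMap_injective.2 <| by
    have := FaithfulSMul.algebraMap_injective A K
    rw [IsScalarTower.algebraMap_eq A B K] at this
    exact .of_comp this
  set m := IsLocalRing.maximalIdeal A
  have hmem : ∀ a, a ∈ m ↔ ν (algebraMap A k a) < 1 := fun a ↦ by
    rw [IsLocalRing.mem_maximalIdeal, mem_nonunits_iff, hν.isUnit_iff_valuation_eq_one,
      (hν.map_le_one a).lt_iff_ne]
  obtain ⟨t, ht⟩ := hsurj (exp (-1 : ℤ))
  obtain ⟨a, rfl⟩ := hν.exists_of_le_one (r := t) (by rw [ht, ← exp_zero, exp_le_exp]; omega)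
  have ha0 : a ≠ 0 := by rintro rfl; rw [map_zero, map_zero] at ht; exact exp_ne_zero ht.symm
  have hma : m = Ideal.span {a} := by
    ext b
    rw [hmem, Ideal.mem_span_singleton, hν.dvd_iff_le, ht]
    rcases eq_or_ne (ν (algebraMap A k b)) 0 with h | h
    · simp [h]
    · rw [← exp_log h, ← exp_zero, exp_lt_exp, exp_le_exp]; omega
  have hm : m ≠ ⊥ := by
    rw [hma, Ne, Ideal.span_singleton_eq_bot]; exact ha0
  have hover : ∀ Q ∈ Qs, Q.IsPrime ∧ Q.LiesOver m := fun Q hQ ↦ by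
    have := hQs Q hQ
    refine ⟨this.isPrime, ⟨?_⟩⟩
    have := Ideal.isMaximal_comap_of_isIntegral_of_isMaximal (R := A) Q
    exact (IsLocalRing.eq_maximalIdeal this).symm
  obtain ⟨Q, hQ⟩ : Qs.Nonempty := by
    rw [← Finset.card_pos, hcard]; exact Module.finrank_pos
  obtain ⟨he, hf⟩ := Ideal.ramificationIdx_inertiaDeg_eq_one_of_finrank_le_card (K := k) (L := K)
    hm Qs hcard.ge hover hQ
  have := hQs Q hQ
  have := (hover Q hQ).1
  have := (hover Q hQ).2
  have hQbot : Q ≠ ⊥ := Ideal.ne_bot_of_liesOver_of_ne_bot hm Q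
  let q : HeightOneSpectrum B := ⟨Q, inferInstance, hQbot⟩
  let v : HeightOneSpectrum A := ⟨m, inferInstance, hm⟩
  have : q.asIdeal.LiesOver v.asIdeal := (hover Q hQ).2
  let : Field (A ⧸ m) := Ideal.Quotient.field m
  refine ⟨q.valuation K, ?_, fun n ↦ ?_⟩
  · have hwa : q.valuation K (algebraMap k K (algebraMap A k a)) = exp (-1 : ℤ) := by
      rw [← HeightOneSpectrum.valuation_liesOver K v q, HeightOneSpectrum.valuation_of_algebraMap,
        v.intValuation_singleton ha0 hma]
      exact (congrArg _ he).trans (pow_one _)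
    have hle : ∀ r, ν r ≤ 1 → q.valuation K (algebraMap k K r) ≤ 1 := fun r hr ↦ by
      obtain ⟨b, rfl⟩ := hν.exists_of_le_one hr
      rw [← IsScalarTower.algebraMap_apply, IsScalarTower.algebraMap_apply A B K]
      exact q.valuation_le_one _
    intro r
    rcases eq_or_ne r 0 with rfl | hr
    · simp
    set j := log (ν r)
    have hj : ν r = exp j := (exp_log (by simpa using hr)).symm
    set u := r * algebraMap A k a ^ j
    have hu : ν u = 1 := by
      simp only [u, map_mul, map_zpow₀, ht, hj]
      rw [← exp_zsmul, ← exp_add]; simp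
    have h1 : q.valuation K (algebraMap k K u) = 1 := by
      refine le_antisymm (hle u hu.le) ?_
      have := hle u⁻¹ (by simp [hu])
      rw [map_inv₀, map_inv₀] at this
      refine (inv_le_one₀ ?_).1 this
      rw [zero_lt_iff, Valuation.ne_zero_iff, _root_.map_ne_zero]
      rintro h; simp [h] at hu
    simp only [u, map_mul, map_zpow₀, hwa] at h1
    rw [hj, eq_comm, ← mul_left_inj' (c := exp (-1 : ℤ) ^ j) (by simp), h1, ← exp_zsmul, ← exp_add]
    simp
  · have hF' : ∀ c : F, ∃ b : A, algebraMap A k b = algebraMap F k c :=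
      fun c ↦ hν.exists_of_le_one (hF c)
    choose f hf' using hF'
    have hsurj' : Function.Surjective fun c ↦ Ideal.Quotient.mk m (f c) := fun x ↦ by
      obtain ⟨b, rfl⟩ := Ideal.Quotient.mk_surjective x
      obtain ⟨c, hc⟩ := hres _ (hν.map_le_one b)
      refine ⟨c, (Ideal.Quotient.eq.2 ?_).symm⟩
      rwa [hmem, _root_.map_sub, hf']
    have : Finite (A ⧸ m) := Finite.of_surjective _ hsurj'
    have hcardQ : Nat.card (B ⧸ Q) = Nat.card (A ⧸ m) := by
      rw [Ideal.inertiaDeg'_algebraMap] at hf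
      rw [Module.natCard_eq_pow_finrank (K := A ⧸ m), hf, pow_one]
    have hcardn : Nat.card (B ⧸ Q ^ n) = Nat.card (A ⧸ m) ^ n := by
      rw [← hcardQ, ← Submodule.cardQuot_apply, cardQuot_pow_of_prime hQbot,
        Submodule.cardQuot_apply]
    have : Finite (B ⧸ Q ^ n) := Nat.finite_of_card_ne_zero (by
      rw [hcardn]; exact pow_ne_zero _ Nat.card_pos.ne')
    let e := (Finite.equivFin (B ⧸ Q ^ n)).toEmbedding.trans
      (Fin.castLEEmb (hcardn.le.trans
        (Nat.pow_le_pow_left (Nat.card_le_card_of_surjective _ hsurj') n)))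
    refine ⟨fun x ↦ e (Ideal.Quotient.mk _ x), fun x y hxy ↦ ?_⟩
    have := Ideal.Quotient.eq.1 (e.injective hxy)
    rw [← q.intValuation_le_pow_iff_mem, ← q.valuation_of_algebraMap (K := K)] at this
    rwa [← _root_.map_sub]

end

open WithZero in
theorem RatFunc.inftyValuation_surjective (F : Type*) [Field F] [DecidableEq (RatFunc F)] :
    Function.Surjective (RatFunc.inftyValuation F) := by
  intro x
  rcases eq_or_ne x 0 with rfl | hx
  · exact ⟨0, map_zero _⟩
  · exact ⟨RatFunc.X ^ log x, (RatFunc.inftyValuation.X_zpow F _).trans (exp_log hx)⟩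

open WithZero in
theorem RatFunc.inftyValuation_algebraMap_le_one {F : Type*} [Field F] [DecidableEq (RatFunc F)]
    (c : F) :
    RatFunc.inftyValuation F (algebraMap F (RatFunc F) c) ≤ 1 := by
  rcases eq_or_ne c 0 with rfl | hc
  · simp
  · rw [RatFunc.algebraMap_eq_C]
    exact (RatFunc.inftyValuation.C F hc).le

open WithZero in
theorem RatFunc.inftyValuation_algebraMap_le_exp_iff {F : Type*} [Field F] [DecidableEq (RatFunc F)]
    (f : Polynomial F) (n : ℕ) :
    RatFunc.inftyValuation F (algebraMap (Polynomial F) (RatFunc F) f) ≤ exp (n : ℤ) ↔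
      f.natDegree ≤ n := by
  rcases eq_or_ne f 0 with rfl | hf
  · simp
  · rw [show RatFunc.inftyValuation F (algebraMap (Polynomial F) (RatFunc F) f) =
      exp (f.natDegree : ℤ) from RatFunc.inftyValuation.polynomial F hf, exp_le_exp, Nat.cast_le]

open WithZero in
theorem RatFunc.exists_inftyValuation_sub_algebraMap_lt_one {F : Type*} [Field F]
    [DecidableEq (RatFunc F)]
    (x : RatFunc F) (hx : RatFunc.inftyValuation F x ≤ 1) :
    ∃ c : F, RatFunc.inftyValuation F (x - algebraMap F (RatFunc F) c) < 1 := by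
  have key : ∀ f : Polynomial F, f ≠ 0 →
      RatFunc.inftyValuation F (algebraMap (Polynomial F) (RatFunc F) f) = exp (f.natDegree : ℤ) :=
    fun f hf ↦ RatFunc.inftyValuation.polynomial F hf
  have hg : x.denom ≠ 0 := x.denom_ne_zero
  have hg' : algebraMap (Polynomial F) (RatFunc F) x.denom ≠ 0 := by simpa using hg
  refine ⟨x.num.coeff x.denom.natDegree, ?_⟩
  set c := x.num.coeff x.denom.natDegree
  have hle : x.num.natDegree ≤ x.denom.natDegree := by
    rcases eq_or_ne x.num 0 with h | h
    · simp [h]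
    rw [← RatFunc.num_div_denom x, map_div₀, key _ hg, key _ h, ← exp_sub, ← exp_zero,
      exp_le_exp] at hx
    omega
  have h1 : x - algebraMap F (RatFunc F) c =
      algebraMap (Polynomial F) (RatFunc F) (x.num - Polynomial.C c * x.denom) /
        algebraMap (Polynomial F) (RatFunc F) x.denom := by
    rw [eq_div_iff hg', map_sub, map_mul, sub_mul, RatFunc.algebraMap_C, RatFunc.algebraMap_eq_C]
    congr 1
    nth_rw 1 [← RatFunc.num_div_denom x]
    exact div_mul_cancel₀ _ hg'
  rcases eq_or_ne (x.num - Polynomial.C c * x.denom) 0 with h | h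
  · rw [h1, h]; simp
  rw [h1, map_div₀, key _ hg, key _ h, ← exp_sub, ← exp_zero, exp_lt_exp, sub_neg, Nat.cast_lt]
  have h2 : (x.num - Polynomial.C c * x.denom).degree < x.denom.natDegree := by
    rw [Polynomial.degree_lt_iff_coeff_zero]
    intro m hm
    rcases hm.eq_or_lt with rfl | hm
    · simp [c, (RatFunc.monic_denom x).coeff_natDegree]
    · rw [Polynomial.coeff_sub, Polynomial.coeff_C_mul, Polynomial.coeff_eq_zero_of_natDegree_lt hm,
        Polynomial.coeff_eq_zero_of_natDegree_lt (hle.trans_lt hm)]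
      simp
  exact (Polynomial.natDegree_lt_iff_degree_lt h).2 h2

open WithZero in
/-- Every element becomes integral over the valuation ring at infinity after division by a large
power of `X`. -/
theorem RatFunc.exists_isIntegral_X_zpow_neg_mul {F A K : Type*} [Field F]
    [DecidableEq (RatFunc F)] [Field K] [Algebra (RatFunc F) K]
    [Algebra.IsAlgebraic (RatFunc F) K] [CommRing A] [Algebra A (RatFunc F)] [Algebra A K]
    [IsScalarTower A (RatFunc F) K] (hν : (RatFunc.inftyValuation F).Integers A) (b : K) :
    ∃ c₀ : ℕ, ∀ c : ℕ, c₀ ≤ c →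
      IsIntegral A (algebraMap (RatFunc F) K (RatFunc.X ^ (-(c : ℤ))) * b) := by
  have : IsDomain A := hν.hom_inj.isDomain
  have : IsFractionRing A (RatFunc F) := hν.isFractionRing
  have : Algebra.IsAlgebraic A K :=
    (IsFractionRing.comap_isAlgebraic_iff (K := RatFunc F)).2 inferInstance
  obtain ⟨a, ha, hab⟩ := (Algebra.IsAlgebraic.isAlgebraic (R := A) b).exists_integral_multiple
  have ha' : algebraMap A (RatFunc F) a ≠ 0 :=
    fun h ↦ ha (hν.hom_inj (h.trans (map_zero _).symm))
  have ha'' : RatFunc.inftyValuation F (algebraMap A (RatFunc F) a) ≠ 0 := by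
    rwa [Valuation.ne_zero_iff]
  refine ⟨(-log (RatFunc.inftyValuation F (algebraMap A (RatFunc F) a))).toNat, fun c hc ↦ ?_⟩
  obtain ⟨e, he⟩ := hν.exists_of_le_one
    (r := RatFunc.X ^ (-(c : ℤ)) / algebraMap A (RatFunc F) a) (by
      rw [map_div₀, RatFunc.inftyValuation.X_zpow, ← exp_log ha'', ← exp_sub, ← exp_zero,
        exp_le_exp]
      omega)
  have : algebraMap (RatFunc F) K (RatFunc.X ^ (-(c : ℤ))) * b = e • a • b := by
    rw [Algebra.smul_def, Algebra.smul_def, ← mul_assoc, ← map_mul,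
      IsScalarTower.algebraMap_apply A (RatFunc F) K, map_mul, he, div_mul_cancel₀ _ ha']
  rw [this]
  exact hab.smul e

open WithZero in
/-- Pigeonhole construction of nonzero integral elements that are small at all but one of the
infinite places of a totally split extension. -/
theorem RatFunc.exists_linear_combination_small {F A B K ι : Type*} [Field F] [Finite F]
    [DecidableEq (RatFunc F)] [Field K] [Algebra (RatFunc F) K] [FiniteDimensional (RatFunc F) K]
    [IsGalois (RatFunc F) K] [CommRing A] [Algebra A (RatFunc F)] [Algebra A K]
    [IsScalarTower A (RatFunc F) K] [CommRing B] [Algebra A B] [Algebra B K]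
    [IsScalarTower A B K] [IsIntegralClosure B A K] [Algebra (Polynomial F) K]
    [IsScalarTower (Polynomial F) (RatFunc F) K]
    (hν : (RatFunc.inftyValuation F).Integers A) {w : Valuation K ℤᵐ⁰}
    (hw : ∀ r, w (algebraMap (RatFunc F) K r) = RatFunc.inftyValuation F r)
    (hπ : ∀ n : ℕ, ∃ π : B → Fin (Nat.card F ^ n),
      ∀ x y, π x = π y → w (algebraMap B K x - algebraMap B K y) ≤ exp (-(n : ℤ)))
    [Fintype ι] (b : Module.Basis ι (RatFunc F) K) (e : ℕ) (he : 0 < e)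
    (hdeg : Module.finrank (RatFunc F) K = e + 1) :
    ∃ c : ℕ, ∀ l : ℕ, ∃ a : ι → Polynomial F, ∑ j, a j • b j ≠ 0 ∧
      (∀ τ : K ≃ₐ[RatFunc F] K, τ ≠ 1 → w (τ (∑ j, a j • b j)) ≤ exp (c - l : ℤ)) ∧
      w (∑ j, a j • b j) ≤ exp (e * (l + 1) + c : ℤ) := by
  classical
  choose c₀ hc₀ using fun j ↦ RatFunc.exists_isIntegral_X_zpow_neg_mul (K := K) hν (b j)
  set c := ∑ j, c₀ j
  have hc : ∀ j, IsIntegral A (algebraMap (RatFunc F) K (RatFunc.X ^ (-(c : ℤ))) * b j) :=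
    fun j ↦ hc₀ j c (Finset.single_le_sum (fun _ _ ↦ Nat.zero_le _) (Finset.mem_univ j))
  refine ⟨c, fun l ↦ ?_⟩
  set m := e * (l + 1) with hm
  set n := e * l + e + l with hn
  let a (v : ι → Polynomial.degreeLT F m) (j : ι) : Polynomial F := v j
  have ha : ∀ v j, RatFunc.inftyValuation F (algebraMap _ (RatFunc F) (a v j)) ≤ exp (m : ℤ) := by
    intro v j
    rw [RatFunc.inftyValuation_algebraMap_le_exp_iff]
    exact Polynomial.natDegree_le_of_degree_le (Polynomial.mem_degreeLT.1 (v j).2).le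
  let X' : RatFunc F := RatFunc.X ^ (-(m + c : ℤ))
  have hX' : RatFunc.inftyValuation F X' = exp (-(m + c : ℤ)) := RatFunc.inftyValuation.X_zpow F _
  let y (v : ι → Polynomial.degreeLT F m) : K := algebraMap _ K X' * ∑ j, a v j • b j
  have hy : ∀ v, IsIntegral A (y v) := by
    intro v
    simp only [y, Finset.mul_sum]
    refine IsIntegral.sum _ fun j _ ↦ ?_
    obtain ⟨f, hf⟩ := hν.exists_of_le_one
      (r := RatFunc.X ^ (-(m : ℤ)) * algebraMap _ (RatFunc F) (a v j)) (by
        rw [map_mul, RatFunc.inftyValuation.X_zpow, exp_neg]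
        exact inv_mul_le_one_of_le₀ (ha v j) (by simp))
    have : algebraMap (RatFunc F) K X' * a v j • b j =
        f • (algebraMap (RatFunc F) K (RatFunc.X ^ (-(c : ℤ))) * b j) := by
      rw [Algebra.smul_def, Algebra.smul_def, ← mul_assoc, ← mul_assoc,
        IsScalarTower.algebraMap_apply (Polynomial F) (RatFunc F) K,
        IsScalarTower.algebraMap_apply A (RatFunc F) K, ← map_mul, ← map_mul, hf,
        mul_right_comm, ← zpow_add₀ RatFunc.X_ne_zero, ← neg_add]
    rw [this]
    exact (hc j).smul f
  have hτy : ∀ v (τ : K ≃ₐ[RatFunc F] K), ∃ z : B, algebraMap B K z = τ (y v) := fun v τ ↦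
    IsIntegralClosure.isIntegral_iff.1 ((hy v).map (τ.toAlgHom.restrictScalars A))
  choose z hz using hτy
  obtain ⟨π, hπn⟩ := hπ n
  let Φ (v : ι → Polynomial.degreeLT F m) (τ : {τ : K ≃ₐ[RatFunc F] K // τ ≠ 1}) := π (z v τ.1)
  have : Fintype F := Fintype.ofFinite F
  have hcard : Nat.card (ι → Polynomial.degreeLT F m) = Nat.card F ^ (m * (e + 1)) := by
    rw [Nat.card_fun, Nat.card_congr (Polynomial.degreeLTEquiv F m).toEquiv, Nat.card_fun,
      Nat.card_fin, Nat.card_eq_fintype_card (α := ι), ← Module.finrank_eq_card_basis b, hdeg,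
      ← pow_mul]
  have hcard' : Nat.card ({τ : K ≃ₐ[RatFunc F] K // τ ≠ 1} → Fin (Nat.card F ^ n)) =
      Nat.card F ^ (n * e) := by
    have : Nat.card {τ : K ≃ₐ[RatFunc F] K // τ ≠ 1} = e := by
      have h := IsGalois.card_aut_eq_finrank (RatFunc F) K
      rw [Nat.card_eq_fintype_card] at h ⊢
      rw [Fintype.card_subtype_compl, h, hdeg, Fintype.card_subtype_eq, Nat.add_sub_cancel]
    rw [Nat.card_fun, this, Nat.card_fin, pow_mul]
  have hlt : Nat.card ({τ : K ≃ₐ[RatFunc F] K // τ ≠ 1} → Fin (Nat.card F ^ n)) <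
      Nat.card (ι → Polynomial.degreeLT F m) := by
    rw [hcard, hcard']
    refine Nat.pow_lt_pow_right Finite.one_lt_card ?_
    rw [hm, hn]; nlinarith
  have hfin : Finite (ι → Polynomial.degreeLT F m) :=
    Nat.finite_of_card_ne_zero (by rw [hcard]; exact pow_ne_zero _ Nat.card_pos.ne')
  obtain ⟨v, v', hvv', hne⟩ : ∃ v v', Φ v = Φ v' ∧ v ≠ v' := by
    by_contra! h
    exact hlt.not_ge (Nat.card_le_card_of_injective Φ fun v v' hv ↦ h v v' hv)
  have hy_sub : y (v - v') = y v - y v' := by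
    simp only [y, ← mul_sub, ← Finset.sum_sub_distrib, ← sub_smul]
    rfl
  have hwy : ∀ τ : K ≃ₐ[RatFunc F] K,
      w (τ (∑ j, a (v - v') j • b j)) = exp (m + c : ℤ) * w (τ (y (v - v'))) := by
    intro τ
    simp only [y, map_mul, AlgEquiv.commutes, hw, hX', ← mul_assoc, ← exp_add]
    simp
  refine ⟨a (v - v'), fun h0 ↦ hne ?_, fun τ hτ ↦ ?_, ?_⟩
  · have h1 : ∑ j, algebraMap _ (RatFunc F) (a (v - v') j) • b j = 0 := by
      simpa [algebraMap_smul] using h0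
    rw [← sub_eq_zero]
    funext j
    have := Fintype.linearIndependent_iff.1 b.linearIndependent _ h1 j
    exact Subtype.ext ((map_eq_zero_iff _ (RatFunc.algebraMap_injective F)).1 this)
  · have h1 : π (z v τ) = π (z v' τ) := congrFun hvv' ⟨τ, hτ⟩
    have h2 := hπn _ _ h1
    rw [hz, hz, ← map_sub, ← hy_sub] at h2
    rw [hwy]
    refine (mul_le_mul_right h2 _).trans ?_
    rw [← exp_add, exp_le_exp]
    push_cast [hm, hn]; linarith
  · have h1 := hwy 1
    rw [AlgEquiv.one_apply, AlgEquiv.one_apply] at h1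
    rw [h1]
    obtain ⟨π₀, hπ₀⟩ := hπ 0
    have h2 := hπ₀ (z (v - v') 1) 0 (Fin.ext (by
      have := (π₀ (z (v - v') 1)).2
      have := (π₀ 0).2
      simp at *
      omega))
    rw [hz, map_zero, sub_zero] at h2
    refine (mul_le_mul_right h2 _).trans ?_
    rw [← exp_add, exp_le_exp]
    push_cast [hm]; linarith

/-- An integral element divides, with integral quotient, its norm down to an integrally closed
base. -/
theorem exists_algebraMap_eq_norm_of_isIntegral {R k K : Type*} [CommRing R] [IsDomain R]
    [IsIntegrallyClosed R] [Field k] [Field K] [Algebra R k] [IsFractionRing R k] [Algebra k K]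
    [Algebra R K] [IsScalarTower R k K] [FiniteDimensional k K] [IsGalois k K] {x : K}
    (hx : IsIntegral R x) :
    ∃ f : R, algebraMap R k f = Algebra.norm k x ∧
      ∃ y : K, IsIntegral R y ∧ algebraMap R K f = x * y := by
  classical
  obtain ⟨f, hf⟩ := IsIntegrallyClosed.isIntegral_iff.1 (Algebra.isIntegral_norm k hx)
  refine ⟨f, hf, ∏ τ ∈ Finset.univ.erase (1 : K ≃ₐ[k] K), τ x, ?_, ?_⟩
  · exact IsIntegral.prod _ fun τ _ ↦ hx.map (τ.toAlgHom.restrictScalars R)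
  · rw [IsScalarTower.algebraMap_apply R k K, hf, Algebra.norm_eq_prod_automorphisms,
      ← Finset.mul_prod_erase _ _ (Finset.mem_univ (1 : K ≃ₐ[k] K)), AlgEquiv.one_apply]

theorem IsIntegral.div_of_sub_eq_smul {R K : Type*} [CommRing R] [Field K] [Algebra R K]
    {x y y' z : K} {f : R} (hy : y ≠ 0) (hy' : IsIntegral R y') (hz : IsIntegral R z)
    (hf : algebraMap R K f = y * y') (hxy : x - y = f • z) : IsIntegral R (x / y) := by
  have : x / y = 1 + y' * z := by
    rw [div_eq_iff hy, sub_eq_iff_eq_add'.1 hxy, Algebra.smul_def, hf]; ring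
  rw [this]
  exact isIntegral_one.add (hy'.mul hz)

open WithZero in
/-- A totally split extension of `F(X)` of degree at least two has a unit that is not a unit at
infinity. -/
theorem RatFunc.exists_isIntegral_inv_one_lt {F A B K : Type*} [Field F] [Finite F]
    [DecidableEq (RatFunc F)] [Field K] [Algebra (RatFunc F) K] [FiniteDimensional (RatFunc F) K]
    [IsGalois (RatFunc F) K] [CommRing A] [Algebra A (RatFunc F)] [Algebra A K]
    [IsScalarTower A (RatFunc F) K] [CommRing B] [Algebra A B] [Algebra B K]
    [IsScalarTower A B K] [IsIntegralClosure B A K] [Algebra (Polynomial F) K]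
    [IsScalarTower (Polynomial F) (RatFunc F) K]
    (hν : (RatFunc.inftyValuation F).Integers A) {w : Valuation K ℤᵐ⁰}
    (hw : ∀ r, w (algebraMap (RatFunc F) K r) = RatFunc.inftyValuation F r)
    (hπ : ∀ n : ℕ, ∃ π : B → Fin (Nat.card F ^ n),
      ∀ x y, π x = π y → w (algebraMap B K x - algebraMap B K y) ≤ exp (-(n : ℤ)))
    (hdeg : 1 < Module.finrank (RatFunc F) K) :
    ∃ u : K, u ≠ 0 ∧ IsIntegral (Polynomial F) u ∧ IsIntegral (Polynomial F) u⁻¹ ∧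
      ∃ τ : K ≃ₐ[RatFunc F] K, 1 < w (τ u) := by
  classical
  obtain ⟨e, he⟩ : ∃ e, Module.finrank (RatFunc F) K = e + 1 :=
    ⟨_, (Nat.sub_add_cancel hdeg.le).symm⟩
  have he0 : 0 < e := by omega
  obtain ⟨s, b, hb⟩ := FiniteDimensional.exists_is_basis_integral (Polynomial F) (RatFunc F) K
  obtain ⟨c, hc⟩ := RatFunc.exists_linear_combination_small hν hw hπ b e he0 he
  choose a ha0 ha1 ha2 using hc
  set x : ℕ → K := fun l ↦ ∑ j, a l j • b j with hx
  have hxint : ∀ l, IsIntegral (Polynomial F) (x l) :=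
    fun l ↦ IsIntegral.sum _ fun j _ ↦ (hb j).smul _
  have hcardG : Nat.card (K ≃ₐ[RatFunc F] K) = e + 1 :=
    (IsGalois.card_aut_eq_finrank (RatFunc F) K).trans he
  choose f hf y hy hfy using fun l ↦
    exists_algebraMap_eq_norm_of_isIntegral (k := RatFunc F) (hxint l)
  have hf0 : ∀ l, f l ≠ 0 := fun l h0 ↦ by
    have := hf l
    rw [h0, map_zero, eq_comm, Algebra.norm_eq_zero_iff] at this
    exact ha0 l this
  set C := e + c + e * c
  have hfdeg : ∀ l, (f l).natDegree ≤ C := fun l ↦ by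
    rw [← RatFunc.inftyValuation_algebraMap_le_exp_iff, hf, ← hw,
      Algebra.norm_eq_prod_automorphisms, map_prod,
      ← Finset.mul_prod_erase _ _ (Finset.mem_univ (1 : K ≃ₐ[RatFunc F] K))]
    refine (mul_le_mul' (ha2 l) (Finset.prod_le_pow_card _ _ (exp (c - l : ℤ)) fun τ hτ ↦
      ha1 l τ (Finset.ne_of_mem_erase hτ))).trans ?_
    rw [Finset.card_erase_of_mem (Finset.mem_univ _), Finset.card_univ, ← Nat.card_eq_fintype_card,
      hcardG, Nat.add_sub_cancel, ← exp_nsmul, ← exp_add, exp_le_exp]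
    push_cast [C, nsmul_eq_mul]; linarith
  have hfmem : ∀ l, f l ∈ Polynomial.degreeLT F (C + 1) := fun l ↦ Polynomial.mem_degreeLT.2 <|
    (Polynomial.degree_le_of_natDegree_le (hfdeg l)).trans_lt (by exact_mod_cast Nat.lt_succ_self C)
  have hmod : ∀ l j, a l j % f l ∈ Polynomial.degreeLT F (C + 1) := fun l j ↦
    Polynomial.mem_degreeLT.2 <|
      (EuclideanDomain.mod_lt _ (hf0 l)).trans (Polynomial.mem_degreeLT.1 (hfmem l))
  have : Finite (Polynomial.degreeLT F (C + 1)) :=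
    Finite.of_equiv _ (Polynomial.degreeLTEquiv F (C + 1)).symm.toEquiv
  let Φ (l : ℕ) : Polynomial.degreeLT F (C + 1) × (s → Polynomial.degreeLT F (C + 1)) :=
    (⟨f l, hfmem l⟩, fun j ↦ ⟨a l j % f l, hmod l j⟩)
  obtain ⟨v, hv⟩ := Finite.exists_infinite_fiber Φ
  obtain ⟨τ, hτ⟩ : ∃ τ : K ≃ₐ[RatFunc F] K, τ ≠ 1 := by
    have : Nontrivial (K ≃ₐ[RatFunc F] K) := by
      rw [← Finite.one_lt_card_iff_nontrivial, hcardG]; omega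
    exact exists_ne 1
  have hinf : (Φ ⁻¹' {v}).Infinite := Set.infinite_coe_iff.1 hv
  obtain ⟨l, hl⟩ := hinf.nonempty
  obtain ⟨l', hl', hll'⟩ := hinf.exists_gt (c - log (w (τ (x l)))).toNat
  have hΦ : Φ l = Φ l' := hl.trans hl'.symm
  have hff : f l = f l' := congrArg Subtype.val (congrArg Prod.fst hΦ)
  have haa : ∀ j, f l ∣ a l j - a l' j := fun j ↦ by
    have := congrArg Subtype.val (congrFun (congrArg Prod.snd hΦ) j)
    change a l j % f l = a l' j % f l' at this
    rw [← hff] at this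
    rw [← EuclideanDomain.mod_eq_zero, Polynomial.sub_mod, this, sub_self]
  choose h hh using haa
  set z := ∑ j, h j • b j
  have hz : IsIntegral (Polynomial F) z := IsIntegral.sum _ fun j _ ↦ (hb j).smul _
  have hxz : x l - x l' = f l • z := by
    simp only [x, z, ← Finset.sum_sub_distrib, ← sub_smul, Finset.smul_sum, smul_smul, hh]
  refine ⟨x l / x l', div_ne_zero (ha0 l) (ha0 l'), ?_, ?_, τ, ?_⟩
  · exact (hy l').div_of_sub_eq_smul (ha0 l') hz (hfy l') (hff ▸ hxz)
  · rw [inv_div]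
    refine (hy l).div_of_sub_eq_smul (z := -z) (ha0 l) hz.neg (hfy l) ?_
    rw [smul_neg, ← hxz, neg_sub]
  · have h1 : ∀ l, w (τ (x l)) ≠ 0 := fun l ↦ by
      rw [Valuation.ne_zero_iff, EmbeddingLike.map_ne_zero_iff]; exact ha0 l
    rw [map_div₀, map_div₀, one_lt_div₀ (zero_lt_iff.2 (h1 l'))]
    refine (ha1 l' τ hτ).trans_lt ?_
    rw [← exp_log (h1 l), exp_lt_exp]
    omega

theorem MulSemiringAction.coeff_charpoly_mem {G K : Type*} [Group G] [Fintype G] [CommRing K]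
    [MulSemiringAction G K] (S : Subring K) {u : K} (hu : ∀ g : G, g • u ∈ S) (i : ℕ) :
    (MulSemiringAction.charpoly G u).coeff i ∈ S := by
  have h : MulSemiringAction.charpoly G u ∈ Polynomial.lifts S.subtype := by
    rw [MulSemiringAction.charpoly_eq]
    refine Subsemiring.prod_mem _ fun g _ ↦ ?_
    exact ⟨Polynomial.X - Polynomial.C ⟨g • u, hu g⟩, by simp⟩
  obtain ⟨a, ha⟩ := (Polynomial.lifts_iff_coeff_lifts _).1 h i
  exact ha ▸ a.2

open WithZero in
/-- An element that is integral over `F[X]` and at all places at infinity is a constant. -/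
theorem RatFunc.isAlgebraic_of_isIntegral_of_le_one {F K : Type*} [Field F]
    [DecidableEq (RatFunc F)] [Field K] [Algebra (RatFunc F) K] [FiniteDimensional (RatFunc F) K]
    [IsGalois (RatFunc F) K] [Algebra (Polynomial F) K]
    [IsScalarTower (Polynomial F) (RatFunc F) K] [Algebra F K] [IsScalarTower F (RatFunc F) K]
    {w : Valuation K ℤᵐ⁰} (hw : ∀ r, w (algebraMap (RatFunc F) K r) = RatFunc.inftyValuation F r)
    {u : K} (hu : IsIntegral (Polynomial F) u) (hwu : ∀ τ : K ≃ₐ[RatFunc F] K, w (τ u) ≤ 1) :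
    IsAlgebraic F u := by
  classical
  set P := MulSemiringAction.charpoly (K ≃ₐ[RatFunc F] K) u
  have hP : P ∈ Polynomial.lifts (algebraMap F K) := by
    rw [Polynomial.lifts_iff_coeff_lifts]
    intro i
    have h1 : IsIntegral (Polynomial F) (P.coeff i) :=
      MulSemiringAction.coeff_charpoly_mem (integralClosure (Polynomial F) K).toSubring
        (fun τ ↦ hu.map (τ.toAlgHom.restrictScalars (Polynomial F))) i
    have h2 : w (P.coeff i) ≤ 1 := MulSemiringAction.coeff_charpoly_mem w.integer hwu i
    obtain ⟨r, hr⟩ := (IsGalois.mem_range_algebraMap_iff_fixed (F := RatFunc F) (P.coeff i)).2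
      fun τ ↦ MulSemiringAction.smul_coeff_charpoly u i τ
    rw [← hr] at h1 h2 ⊢
    rw [isIntegral_algebraMap_iff (FaithfulSMul.algebraMap_injective (RatFunc F) K)] at h1
    obtain ⟨f, rfl⟩ := IsIntegrallyClosed.isIntegral_iff.1 h1
    rw [hw, ← exp_zero, ← Nat.cast_zero, RatFunc.inftyValuation_algebraMap_le_exp_iff,
      Nat.le_zero, Polynomial.natDegree_eq_zero] at h2
    obtain ⟨a, rfl⟩ := h2
    exact ⟨a, by rw [RatFunc.algebraMap_C, ← RatFunc.algebraMap_eq_C,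
      ← IsScalarTower.algebraMap_apply]⟩
  obtain ⟨Q, hQ, -, hmonic⟩ := Polynomial.lifts_and_degree_eq_and_monic hP
    (MulSemiringAction.monic_charpoly _ u)
  refine IsIntegral.isAlgebraic ⟨Q, hmonic, ?_⟩
  rw [← Polynomial.eval_map, hQ]
  exact MulSemiringAction.eval_charpoly _ u

theorem RatFunc.exists_algebraMap_eq_prod_of_isIntegral_inv {F K : Type*} [Field F]
    [Field K] [Algebra (RatFunc F) K] [FiniteDimensional (RatFunc F) K]
    [IsGalois (RatFunc F) K] [Algebra (Polynomial F) K]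
    [IsScalarTower (Polynomial F) (RatFunc F) K] [Algebra F K] [IsScalarTower F (RatFunc F) K]
    {u : K} (hu0 : u ≠ 0) (hu : IsIntegral (Polynomial F) u)
    (hu' : IsIntegral (Polynomial F) u⁻¹) :
    ∃ a : F, a ≠ 0 ∧ algebraMap F K a = ∏ τ : K ≃ₐ[RatFunc F] K, τ u := by
  obtain ⟨f, hf⟩ := IsIntegrallyClosed.isIntegral_iff.1 (Algebra.isIntegral_norm (RatFunc F) hu)
  obtain ⟨f', hf'⟩ := IsIntegrallyClosed.isIntegral_iff.1 (Algebra.isIntegral_norm (RatFunc F) hu')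
  have h1 : f * f' = 1 := by
    apply RatFunc.algebraMap_injective F
    rw [map_mul, hf, hf', ← map_mul, mul_inv_cancel₀ hu0, map_one, map_one]
  obtain ⟨a, ha, rfl⟩ := Polynomial.isUnit_iff.1 (IsUnit.of_mul_eq_one _ h1)
  refine ⟨a, ha.ne_zero, ?_⟩
  rw [← Algebra.norm_eq_prod_automorphisms, ← hf, RatFunc.algebraMap_C, ← RatFunc.algebraMap_eq_C,
      ← IsScalarTower.algebraMap_apply]

open Polynomial in
/-- A cyclic action of order `p` without norm on a lattice of small rank: coinvariants have
order `p`. -/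
theorem Module.natCard_quotient_range_sub_one_eq_prime {M : Type*} [AddCommGroup M]
    [Module.Free ℤ M] [Module.Finite ℤ M] {p : ℕ} (hp : p.Prime) (hpos : 0 < Module.finrank ℤ M)
    (hlt : Module.finrank ℤ M < p) (s : Module.End ℤ M)
    (hs : ∑ i ∈ Finset.range p, s ^ i = 0) :
    Nat.card (M ⧸ LinearMap.range (s - 1)) = p := by
  have : Fact p.Prime := ⟨hp⟩
  let b := Module.finBasis ℤ M
  set A := LinearMap.toMatrixAlgEquiv b s with hA
  let A' := A.map (algebraMap ℤ ℚ)
  have hn : Nonempty (Fin (Module.finrank ℤ M)) := Fin.pos_iff_nonempty.1 hpos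
  have hA0 : ∑ i ∈ Finset.range p, A ^ i = 0 := by
    have := congrArg (LinearMap.toMatrixAlgEquiv b) hs
    simpa [map_sum, map_pow, hA] using this
  have hA1 : ∑ i ∈ Finset.range p, A' ^ i = 0 := by
    have := congrArg (algebraMap ℤ ℚ).mapMatrix hA0
    simpa only [map_sum, map_pow, map_zero, RingHom.mapMatrix_apply] using this
  have haev : aeval A' (cyclotomic p ℚ) = 0 := by
    simpa [cyclotomic_prime] using hA1
  have hmin : cyclotomic p ℚ = minpoly ℚ A' :=
    minpoly.eq_of_irreducible_of_monic (cyclotomic.irreducible_rat hp.pos) haev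
      (cyclotomic.monic p ℚ)
  have hchar : A'.charpoly = cyclotomic p ℚ := by
    refine eq_of_monic_of_dvd_of_natDegree_le (cyclotomic.monic p ℚ) A'.charpoly_monic
      (hmin ▸ Matrix.minpoly_dvd_charpoly A') ?_
    rw [natDegree_cyclotomic, Nat.totient_prime hp, Matrix.charpoly_natDegree_eq_dim]
    simp only [Fintype.card_fin]; omega
  have hdet : (1 - A).det = p := by
    have : ((1 - A).det : ℚ) = p := by
      have h := congrArg (eval 1) hchar
      rw [Matrix.eval_charpoly, eval_one_cyclotomic_prime] at h
      rw [← h]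
      have := RingHom.map_det (algebraMap ℤ ℚ) (1 - A)
      rw [map_sub, map_one] at this
      simpa [A'] using this
    exact_mod_cast this
  have habs : (LinearMap.det (s - 1)).natAbs = p := by
    have h1 : LinearMap.det (1 - s : Module.End ℤ M) = (p : ℤ) := by
      rw [← LinearMap.det_toMatrix b, map_sub, LinearMap.toMatrix_one]; exact hdet
    rw [← neg_sub 1 s, ← neg_one_smul ℤ (1 - s), LinearMap.det_smul, h1]
    simp [Int.natAbs_mul, Int.natAbs_pow]
  have hinj : Function.Injective (s - 1 : Module.End ℤ M) := by
    rw [← LinearMap.ker_eq_bot]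
    by_contra h
    rw [← Ne, ← LinearMap.det_eq_zero_iff_ker_ne_bot, ← Int.natAbs_eq_zero, habs] at h
    exact hp.ne_zero h
  rw [← habs]
  rw [← Submodule.natAbs_det_equiv _ (LinearEquiv.ofInjective (s - 1 : Module.End ℤ M) hinj)]
  rfl

open Multiplicative in
/-- `Ĥ⁻¹` of a multiplicative group `U` with an action of a cyclic group of prime order `p`, when
`U` is an extension of a lattice of rank at most `p - 1` without norms by a uniquely `p`-divisible
group with trivial action. -/
theorem Subgroup.nonempty_norm_ker_quotient_mulEquiv_zmod {V M : Type*} [CommGroup V]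
    [AddCommGroup M] [Module.Free ℤ M] [Module.Finite ℤ M] {p : ℕ} (hp : p.Prime)
    (hpos : 0 < Module.finrank ℤ M) (hlt : Module.finrank ℤ M < p) (t : Module.End ℤ M)
    (ht : ∑ i ∈ Finset.range p, t ^ i = 0) (s N φ : V →* V)
    (hN : ∀ x, N x = ∏ i ∈ Finset.range p, s^[i] x) (hφ : ∀ x, φ x = s x / x)
    (U : Subgroup V) (hsU : ∀ u ∈ U, s u ∈ U) (v : U →* Multiplicative M)
    (hv : Function.Surjective v) (hvs : ∀ u : U, toAdd (v ⟨s u, hsU u u.2⟩) = t (toAdd (v u)))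
    (hfix : ∀ u : U, v u = 1 → s u = u) (htors : ∀ u : U, v u = 1 → u ^ p = 1 → u = 1)
    (hdiv : ∀ u : U, v u = 1 → ∃ d : U, v d = 1 ∧ d ^ p = u) :
    Nonempty (((U ⊓ N.ker : Subgroup V) ⧸
      ((Subgroup.map φ U).subgroupOf (U ⊓ N.ker))) ≃* Multiplicative (ZMod p)) := by
  have hsU' : ∀ i, ∀ u ∈ U, s^[i] u ∈ U := fun i u hu ↦ by
    induction i with
    | zero => exact hu
    | succ i ih => rw [Function.iterate_succ_apply']; exact hsU _ ih
  have hvs' : ∀ i (u : U), toAdd (v ⟨s^[i] u, hsU' i u u.2⟩) = (t ^ i) (toAdd (v u)) := fun i u ↦ by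
    induction i with
    | zero => rfl
    | succ i ih =>
      rw [pow_succ', Module.End.mul_apply, ← ih, ← hvs]
      simp only [Function.iterate_succ_apply']
  have hNU : ∀ u ∈ U, N u ∈ U := fun u hu ↦ by
    rw [hN]; exact U.prod_mem fun i _ ↦ hsU' i u hu
  have hvN : ∀ u : U, v ⟨N u, hNU u u.2⟩ = 1 := fun u ↦ by
    have : (⟨N u, hNU u u.2⟩ : U) = ∏ i ∈ Finset.range p, ⟨s^[i] u, hsU' i u u.2⟩ :=
      Subtype.ext (by simp [hN])
    rw [this, map_prod]
    apply toAdd.injective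
    rw [toAdd_prod, toAdd_one, Finset.sum_congr rfl fun i _ ↦ hvs' i u, ← LinearMap.sum_apply, ht,
      LinearMap.zero_apply]
  have hNfix : ∀ u : U, v u = 1 → N u = (u : V) ^ p := fun u hu ↦ by
    have : ∀ i, s^[i] (u : V) = u := fun i ↦ Function.iterate_fixed (hfix u hu) i
    simp [hN, this]
  have hNs : ∀ u : U, N (s u) = N u := fun u ↦ by
    refine Eq.trans ?_ (hfix _ (hvN u))
    simp only [hN, map_prod, ← Function.iterate_succ_apply, ← Function.iterate_succ_apply']
  have hNφ : ∀ u : U, N (φ u) = 1 := fun u ↦ by rw [hφ, map_div, hNs, div_self']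
  set R := LinearMap.range (t - 1)
  let Ψ : (U ⊓ N.ker : Subgroup V) →* Multiplicative (M ⧸ R) :=
    (AddMonoidHom.toMultiplicative R.mkQ.toAddMonoidHom).comp
      (v.comp (Subgroup.inclusion inf_le_left))
  have hΨ : ∀ x (hx : x ∈ U ⊓ N.ker), Ψ ⟨x, hx⟩ =
      ofAdd (R.mkQ (toAdd (v ⟨x, (Subgroup.mem_inf.1 hx).1⟩))) :=
    fun _ _ ↦ rfl
  have hsurj : Function.Surjective Ψ := by
    intro m
    obtain ⟨m, hm⟩ := R.mkQ_surjective (toAdd m)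
    obtain ⟨u, hu⟩ := hv (ofAdd m)
    obtain ⟨d, hd, hdp⟩ := hdiv _ (hvN u)
    have hud : ((u / d : U) : V) ∈ U ⊓ N.ker := Subgroup.mem_inf.2 ⟨(u / d).2, by
      rw [MonoidHom.mem_ker, Subgroup.coe_div, map_div, hNfix d hd, div_eq_one]
      exact (congrArg Subtype.val hdp).symm⟩
    refine ⟨⟨_, hud⟩, toAdd.injective ?_⟩
    have : toAdd (v (u / d)) = m := by rw [map_div, hu, hd, div_one, toAdd_ofAdd]
    rw [hΨ, ← hm, toAdd_ofAdd, ← this]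
  have hker : Ψ.ker = (Subgroup.map φ U).subgroupOf (U ⊓ N.ker) := by
    have hvφ : ∀ (y : U) (h : φ y ∈ U), toAdd (v ⟨φ y, h⟩) = (t - 1) (toAdd (v y)) := fun y h ↦ by
      have : (⟨φ y, h⟩ : U) = ⟨s y, hsU y y.2⟩ / y := Subtype.ext (hφ y)
      rw [this, map_div, toAdd_div, hvs]; rfl
    have hφU : ∀ y ∈ U, φ y ∈ U := fun y hy ↦ by rw [hφ]; exact U.div_mem (hsU y hy) hy
    ext ⟨x, hx⟩
    obtain ⟨hxU, hxN⟩ := Subgroup.mem_inf.1 hx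
    rw [MonoidHom.mem_ker, hΨ, Subgroup.mem_subgroupOf, ofAdd_eq_one, Submodule.mkQ_apply,
      Submodule.Quotient.mk_eq_zero]
    constructor
    · rintro ⟨m, hm⟩
      obtain ⟨y, hy⟩ := hv (ofAdd m)
      have hφy := hφU y y.2
      have hc : v (⟨x, hxU⟩ / ⟨φ y, hφy⟩) = 1 := by
        rw [map_div, div_eq_one]
        apply toAdd.injective
        rw [hvφ, hy, toAdd_ofAdd, hm]
      refine ⟨y, y.2, ?_⟩
      have hcp : (⟨x, hxU⟩ / ⟨φ y, hφy⟩ : U) ^ p = 1 := by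
        apply Subtype.ext
        rw [Subgroup.coe_pow, ← hNfix _ hc, Subgroup.coe_div, map_div, MonoidHom.mem_ker.1 hxN, hNφ,
          div_one, Subgroup.coe_one]
      exact (congrArg Subtype.val (div_eq_one.1 (htors _ hc hcp))).symm
    · rintro ⟨y, hy, rfl⟩
      exact ⟨_, (hvφ ⟨y, hy⟩ hxU).symm⟩
  have hcard : Nat.card (M ⧸ R) = p :=
    Module.natCard_quotient_range_sub_one_eq_prime hp hpos hlt t ht
  have hcard' : Nat.card (Multiplicative (M ⧸ R)) = p := hcard
  have : Fact p.Prime := ⟨hp⟩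
  exact ⟨((QuotientGroup.quotientMulEquivOfEq hker.symm).trans
    (QuotientGroup.quotientKerEquivOfSurjective Ψ hsurj)).trans
    (mulEquivOfPrimeCardEq hcard' (by simp))⟩

theorem WithZero.exp_sum {ι M : Type*} [AddCommMonoid M] (s : Finset ι) (f : ι → M) :
    exp (∑ i ∈ s, f i) = ∏ i ∈ s, exp (f i) := by
  induction s using Finset.cons_induction with
  | empty => rfl
  | cons a s ha ih => rw [Finset.sum_cons, Finset.prod_cons, exp_add, ih]

open WithZero Multiplicative in
/-- The Galois module structure of `S`-units at the places above a totally split place, in prime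
degree, as far as it is needed to compute `Ĥ⁻¹`. -/
theorem IsGalois.nonempty_norm_ker_quotient_mulEquiv_zmod {k K : Type*} [Field k] [Field K]
    [Algebra k K] [FiniteDimensional k K] [IsGalois k K] {p : ℕ} (hp : p.Prime)
    (hdeg : Module.finrank k K = p) (w : Valuation K ℤᵐ⁰) (σ : K ≃ₐ[k] K)
    (hσ : ∀ τ : K ≃ₐ[k] K, τ ∈ Subgroup.zpowers σ) (U : Subgroup Kˣ)
    (hσU : ∀ u ∈ U, Units.map (σ : K →* K) u ∈ U)
    (hprod : ∀ u ∈ U, w (∏ τ : K ≃ₐ[k] K, τ (u : K)) = 1)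
    (hne : ∃ u ∈ U, ∃ τ : K ≃ₐ[k] K, w (τ (u : K)) ≠ 1)
    (hconst : ∀ u ∈ U, (∀ τ : K ≃ₐ[k] K, w (τ (u : K)) = 1) → σ (u : K) = u ∧
      (u ^ p = 1 → u = 1) ∧ ∃ d ∈ U, (∀ τ : K ≃ₐ[k] K, w (τ (d : K)) = 1) ∧ d ^ p = u)
    (N φ : Kˣ →* Kˣ)
    (hN : N = ∏ i ∈ Finset.range p, (Units.map ((σ ^ i : K ≃ₐ[k] K) : K →* K) : Kˣ →* Kˣ))
    (hφ : φ = (Units.map (σ : K →* K) : Kˣ →* Kˣ) * (MonoidHom.id Kˣ)⁻¹) :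
    Nonempty (((U ⊓ N.ker : Subgroup Kˣ) ⧸
      ((Subgroup.map φ U).subgroupOf (U ⊓ N.ker))) ≃* Multiplicative (ZMod p)) := by
  classical
  have hw0 : ∀ (τ : K ≃ₐ[k] K) (u : Kˣ), w (τ (u : K)) ≠ 0 := fun τ u ↦ by
    rw [Valuation.ne_zero_iff, EmbeddingLike.map_ne_zero_iff]; exact u.ne_zero
  let f : Additive U →ₗ[ℤ] ((K ≃ₐ[k] K) → ℤ) := AddMonoidHom.toIntLinearMap <|
    AddMonoidHom.mk' (fun u τ ↦ log (w (τ (u.toMul : Kˣ)))) fun a b ↦ by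
      funext τ
      simp [log_mul (hw0 _ _) (hw0 _ _)]
  have hf : ∀ (u : U) τ, f (Additive.ofMul u) τ = log (w (τ (u : Kˣ))) := fun _ _ ↦ rfl
  let S : Module.End ℤ ((K ≃ₐ[k] K) → ℤ) := LinearMap.funLeft ℤ ℤ (· * σ)
  have hfS : ∀ u : U, f (Additive.ofMul ⟨_, hσU u u.2⟩) = S (f (Additive.ofMul u)) := fun _ ↦ rfl
  let M := LinearMap.range f
  have hSM : ∀ m ∈ M, S m ∈ M := by
    rintro _ ⟨u, rfl⟩
    exact ⟨_, hfS u.toMul⟩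
  let v : U →* Multiplicative M := AddMonoidHom.toMultiplicativeRight f.rangeRestrict.toAddMonoidHom
  have hv1 : ∀ u : U, v u = 1 ↔ ∀ τ : K ≃ₐ[k] K, w (τ (u : Kˣ)) = 1 := fun u ↦ by
    have : v u = 1 ↔ f (Additive.ofMul u) = 0 := Subtype.ext_iff
    rw [this, funext_iff]
    refine forall_congr' fun τ ↦ ?_
    rw [hf, Pi.zero_apply, ← exp_inj, exp_log (hw0 τ u), exp_zero]
  have hcardG : Fintype.card (K ≃ₐ[k] K) = p := by
    rw [← Nat.card_eq_fintype_card, IsGalois.card_aut_eq_finrank, hdeg]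
  let L : ((K ≃ₐ[k] K) → ℤ) →ₗ[ℤ] ℤ := ∑ τ, LinearMap.proj τ
  have hL : ∀ m ∈ M, L m = 0 := by
    rintro _ ⟨u, rfl⟩
    have h := hprod _ u.toMul.2
    rw [map_prod, Finset.prod_congr rfl fun τ _ ↦ (exp_log (hw0 τ u.toMul)).symm, ← exp_sum,
      ← exp_zero, exp_inj] at h
    simpa [L, f] using h
  have hsum : ∀ m, ∑ i ∈ Finset.range p, (S ^ i) m = fun _ ↦ L m := fun m ↦ by
    have hS : ∀ i τ, (S ^ i) m τ = m (τ * σ ^ i) := fun i ↦ by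
      induction i with
      | zero => simp
      | succ i ih =>
        intro τ
        rw [pow_succ', Module.End.mul_apply, pow_succ', ← mul_assoc, ← ih]; rfl
    funext τ
    have hinj : Set.InjOn (fun i ↦ σ ^ i) (Finset.range p) := by
      rw [← Finset.card_image_iff, ← hcardG, ← Nat.card_eq_fintype_card,
        IsCyclic.image_range_card hσ,
        Finset.card_univ, Finset.card_range, Nat.card_eq_fintype_card]
    have himg : (Finset.range p).image (fun i ↦ σ ^ i) = Finset.univ := by
      rw [← hcardG, ← Nat.card_eq_fintype_card, IsCyclic.image_range_card hσ]
    simp only [Finset.sum_apply, hS, L, LinearMap.sum_apply, LinearMap.proj_apply]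
    rw [← Finset.sum_image (f := fun g ↦ m (τ * g)) hinj, himg]
    exact (Group.mulLeft_bijective τ).sum_comp m
  have hpos : 0 < Module.finrank ℤ M := by
    have : Nontrivial M := by
      obtain ⟨u, hu, τ, hτ⟩ := hne
      refine ⟨⟨_, ⟨Additive.ofMul ⟨u, hu⟩, rfl⟩⟩, 0, fun h ↦ hτ ?_⟩
      exact (hv1 ⟨u, hu⟩).1 h τ
    exact Module.finrank_pos
  have hlt : Module.finrank ℤ M < p := by
    have h1 := Submodule.finrank_quotient_add_finrank (LinearMap.ker L)
    have h2 : LinearMap.range L = ⊤ := by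
      rw [LinearMap.range_eq_top]
      exact fun n ↦ ⟨Pi.single 1 n, by simp [L]⟩
    rw [L.quotKerEquivRange.finrank_eq, h2, finrank_top, Module.finrank_self,
      Module.finrank_fintype_fun_eq_card, hcardG] at h1
    have h3 : Module.finrank ℤ M ≤ Module.finrank ℤ (LinearMap.ker L) := Submodule.finrank_mono hL
    omega
  refine Subgroup.nonempty_norm_ker_quotient_mulEquiv_zmod hp hpos hlt (S.restrict hSM) ?_
    (Units.map (σ : K →* K)) N φ ?_ ?_ U hσU v ?_ ?_ ?_ ?_ ?_
  · ext1 m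
    apply Subtype.ext
    have h1 : ∀ i, (((S.restrict hSM) ^ i) m : (K ≃ₐ[k] K) → ℤ) = (S ^ i) m := fun i ↦ by
      rw [Module.End.pow_restrict]; rfl
    rw [LinearMap.sum_apply, AddSubmonoidClass.coe_finsetSum, Finset.sum_congr rfl fun i _ ↦ h1 i,
      hsum, hL m m.2]
    rfl
  · intro x
    have h1 : ∀ i, Units.map ((σ ^ i : K ≃ₐ[k] K) : K →* K) x = (Units.map (σ : K →* K))^[i] x :=
      fun i ↦ by
        induction i with
        | zero => exact Units.ext rfl
        | succ i ih =>
          rw [Function.iterate_succ_apply', ← ih, pow_succ']; exact Units.ext rfl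
    rw [hN, MonoidHom.finsetProd_apply]
    exact Finset.prod_congr rfl fun i _ ↦ h1 i
  · intro x
    rw [hφ]; rfl
  · rintro ⟨_, u, rfl⟩
    exact ⟨u.toMul, rfl⟩
  · intro u; rfl
  · exact fun u hu ↦ Units.ext (hconst u u.2 ((hv1 u).1 hu)).1
  · exact fun u hu h ↦ Subtype.ext ((hconst u u.2 ((hv1 u).1 hu)).2.1 (congrArg Subtype.val h))
  · intro u hu
    obtain ⟨d, hd, hd1, hdp⟩ := (hconst u u.2 ((hv1 u).1 hu)).2.2
    exact ⟨⟨d, hd⟩, (hv1 ⟨d, hd⟩).2 hd1, Subtype.ext hdp⟩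

/-- Let `K/k` be a real Artin-Schreier extension of `k = F_q(t)` of degree `p`
(the infinite place of `k` splits completely in `K`, i.e. there are `p` distinct
places of `K` above it, realized as maximal ideals of the integral closure `B∞`
of the valuation ring at infinity), with `G = Gal(K/k) = ⟨σ⟩ ≅ ℤ/pℤ` and `U_K`
the unit group of the integral closure of `F_q[t]` in `K`.  Then
`H¹(G, U_K) ≅ F_p`, where `H¹` of the cyclic group `G` is
`(U_K ∩ ker N)/(σ-1)U_K`. -/
theorem real_H1_units_iso_Fp
    (p : ℕ) (hp : p.Prime)
    (Fq : Type*) [Field Fq] [Fintype Fq] [CharP Fq p] [DecidableEq (RatFunc Fq)]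
    (K : Type*) [Field K] [Algebra (RatFunc Fq) K]
    [FiniteDimensional (RatFunc Fq) K] [IsGalois (RatFunc Fq) K]
    (hdeg : Module.finrank (RatFunc Fq) K = p)
    [Algebra Fq K] [IsScalarTower Fq (RatFunc Fq) K]
    [Algebra (Polynomial Fq) K] [IsScalarTower (Polynomial Fq) (RatFunc Fq) K]
    -- Artin-Schreier generator
    (α : K) (D : RatFunc Fq)
    (hα : α ^ p - α = algebraMap (RatFunc Fq) K D)
    (hadj : Algebra.adjoin (RatFunc Fq) {α} = ⊤)
    -- the extension is geometric
    (hgeo : ∀ x : K, IsAlgebraic Fq x → x ∈ (algebraMap Fq K).range)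
    -- `K` is real: the infinite place splits completely, i.e. there are `p`
    -- distinct places of `K` above infinity
    [Algebra (FunctionField.inftyValuation Fq).valuationSubring K]
    [IsScalarTower (FunctionField.inftyValuation Fq).valuationSubring (RatFunc Fq) K]
    (hreal : ∃ Qs : Finset (Ideal
        (integralClosure (FunctionField.inftyValuation Fq).valuationSubring K)),
      Qs.card = p ∧ ∀ Q ∈ Qs, Q.IsMaximal)
    (σ : K ≃ₐ[RatFunc Fq] K) (hσ : ∀ τ : K ≃ₐ[RatFunc Fq] K, τ ∈ Subgroup.zpowers σ)
    (U : Subgroup Kˣ)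
    (hU : U = MonoidHom.range (Units.map
      (RingHom.toMonoidHom (algebraMap (integralClosure (Polynomial Fq) K) K))))
    (N φ : Kˣ →* Kˣ)
    (hN : N = ∏ i ∈ Finset.range p,
      (Units.map ((σ ^ i : K ≃ₐ[RatFunc Fq] K) : K →* K) : Kˣ →* Kˣ))
    (hφ : φ = (Units.map (σ : K →* K) : Kˣ →* Kˣ) * (MonoidHom.id Kˣ)⁻¹) :
    Nonempty (((U ⊓ N.ker : Subgroup Kˣ) ⧸
        ((Subgroup.map φ U).subgroupOf (U ⊓ N.ker))) ≃* Multiplicative (ZMod p)) := by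
  classical
  have : Fact p.Prime := ⟨hp⟩
  obtain ⟨Qs, hcard, hQs⟩ := hreal
  have hν : (FunctionField.inftyValuation Fq).Integers
    (FunctionField.inftyValuation Fq).valuationSubring := Valuation.valuationSubring.integers _
  obtain ⟨w, hw, hπ⟩ := hν.exists_extension_of_splits (F := Fq) (K := K)
    (RatFunc.inftyValuation_surjective Fq) RatFunc.exists_inftyValuation_sub_algebraMap_lt_one
    RatFunc.inftyValuation_algebraMap_le_one Qs (hcard.trans hdeg.symm) hQs
  have hmem : ∀ u : Kˣ, u ∈ U ↔
      IsIntegral (Polynomial Fq) (u : K) ∧ IsIntegral (Polynomial Fq) (u : K)⁻¹ := fun u ↦ by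
    rw [hU]
    constructor
    · rintro ⟨x, rfl⟩
      refine ⟨(x : integralClosure (Polynomial Fq) K).2, ?_⟩
      rw [← Units.val_inv_eq_inv_val, ← map_inv]
      exact (x⁻¹ : (integralClosure (Polynomial Fq) K)ˣ).1.2
    · rintro ⟨h1, h2⟩
      exact ⟨⟨⟨u, h1⟩, ⟨(u : K)⁻¹, h2⟩, Subtype.ext (mul_inv_cancel₀ u.ne_zero),
        Subtype.ext (inv_mul_cancel₀ u.ne_zero)⟩, Units.ext rfl⟩
  have hwC : ∀ a : Fq, a ≠ 0 → w (algebraMap Fq K a) = 1 := fun a ha ↦ by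
    rw [IsScalarTower.algebraMap_apply Fq (RatFunc Fq) K, hw, RatFunc.algebraMap_eq_C]
    exact RatFunc.inftyValuation.C Fq ha
  have hτC : ∀ (τ : K ≃ₐ[RatFunc Fq] K) (a : Fq), τ (algebraMap Fq K a) = algebraMap Fq K a :=
    fun τ a ↦ by rw [IsScalarTower.algebraMap_apply Fq (RatFunc Fq) K, AlgEquiv.commutes]
  have hint : ∀ a : Fq, IsIntegral (Polynomial Fq) (algebraMap Fq K a) := fun a ↦ by
    rw [IsScalarTower.algebraMap_apply Fq (RatFunc Fq) K, RatFunc.algebraMap_eq_C,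
      ← RatFunc.algebraMap_C, ← IsScalarTower.algebraMap_apply]
    exact isIntegral_algebraMap
  have : CharP K p := charP_of_injective_algebraMap (algebraMap Fq K).injective p
  refine IsGalois.nonempty_norm_ker_quotient_mulEquiv_zmod hp hdeg w σ hσ U ?_ ?_ ?_ ?_ N φ hN hφ
  · intro u hu
    rw [hmem] at hu ⊢
    have := hu.2.map (σ.toAlgHom.restrictScalars (Polynomial Fq))
    exact ⟨hu.1.map (σ.toAlgHom.restrictScalars (Polynomial Fq)), by simpa using this⟩
  · intro u hu
    obtain ⟨h1, h2⟩ := (hmem u).1 hu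
    obtain ⟨a, ha, hau⟩ := RatFunc.exists_algebraMap_eq_prod_of_isIntegral_inv u.ne_zero h1 h2
    rw [← hau, hwC a ha]
  · obtain ⟨u, hu0, h1, h2, τ, hτ⟩ :=
      RatFunc.exists_isIntegral_inv_one_lt hν hw hπ (hdeg.symm ▸ hp.one_lt)
    exact ⟨Units.mk0 u hu0, (hmem _).2 ⟨h1, h2⟩, τ, hτ.ne'⟩
  · intro u hu hwu
    obtain ⟨a, ha⟩ := hgeo u (RatFunc.isAlgebraic_of_isIntegral_of_le_one hw ((hmem u).1 hu).1
      fun τ ↦ (hwu τ).le)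
    have ha0 : a ≠ 0 := by
      rintro rfl
      exact u.ne_zero (by rw [← ha, map_zero])
    refine ⟨by rw [← ha, hτC], fun h ↦ ?_, ?_⟩
    · have := congrArg Units.val h
      rw [Units.val_pow_eq_pow_val, Units.val_one] at this
      exact Units.ext (frobenius_inj K p (by simpa [frobenius_def] using this))
    · obtain ⟨d, rfl⟩ := (bijective_frobenius Fq p).2 a
      have hd0 : d ≠ 0 := by
        rintro rfl
        simp [frobenius_def, hp.ne_zero] at ha0
      refine ⟨Units.mk0 (algebraMap Fq K d) (by simpa using hd0), (hmem _).2 ⟨hint d, ?_⟩,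
        fun τ ↦ ?_, Units.ext ?_⟩
      · simpa using hint d⁻¹
      · rw [Units.val_mk0, hτC, hwC d hd0]
      · rw [Units.val_pow_eq_pow_val, Units.val_mk0, ← map_pow, ← ha, frobenius_def]
end

section
/- The fields k(α_1), ..., k(α_m), k(β) (with α_i^p − α_i = D_i = Q_i/P_i^{e_i}, β^p − β = f(t), in normalized form with distinct P_i and f nonconstant or a nontrivial constant) are linearly disjoint over k; consequently [k(α_1, ..., α_m, β) : k] = p^{m+1}. -/
set_option synthInstance.maxHeartbeats 1000000
set_option maxHeartbeats 4000000

open Polynomial in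
theorem ArtinSchreier.isSeparable {k E : Type*} [Field k] [Field E] [Algebra k E] {p : ℕ}
    [CharP k p] {a : k} {α : E} (h : α ^ p - α = algebraMap k E a) :
    IsSeparable k α := by
  have hsep : (X ^ p - X - C a : k[X]).Separable := by
    rw [separable_def']
    refine ⟨0, -1, ?_⟩
    simp [derivative_X_pow]
  refine hsep.of_dvd (minpoly.dvd k α ?_)
  simp [h]

theorem ArtinSchreier.exists_cast_eq_of_pow_eq_self {E : Type*} [Field E] {p : ℕ} [Fact p.Prime]
    [CharP E p] {x : E} (hx : x ^ p = x) : ∃ c : ZMod p, ZMod.castHom dvd_rfl E c = x := by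
  have := (Subfield.mem_bot_iff_pow_eq_self (F := E) (p := p)).2 hx
  rwa [← ZMod.fieldRange_castHom_eq_bot p] at this

open IntermediateField in
/-- The Galois group of the compositum of Artin-Schreier extensions embeds into `(ℤ/p)^ι` through
`σ ↦ σ α - α`, and a linear form vanishing on the image gives an `𝔽_p`-linear relation between the
classes of the `a i` modulo the image of `x ↦ x ^ p - x`. -/
theorem ArtinSchreier.finrank_adjoin_range {k Ω ι : Type*} [Field k] [Field Ω] [Algebra k Ω]
    [Normal k Ω] [Fintype ι] {p : ℕ} [Fact p.Prime] [CharP k p] (a : ι → k) (α : ι → Ω)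
    (hα : ∀ i, α i ^ p - α i = algebraMap k Ω (a i))
    (ha : ∀ (c : ι → ZMod p) (y : k),
      y ^ p - y = ∑ i, ZMod.castHom dvd_rfl k (c i) * a i → c = 0) :
    Module.finrank k (adjoin k (Set.range α)) = p ^ Fintype.card ι := by
  classical
  have : CharP Ω p := charP_of_injective_algebraMap (algebraMap k Ω).injective p
  have : CharP (adjoin k (Set.range α)) p :=
    charP_of_injective_algebraMap (algebraMap k _).injective p
  have hp : p.Prime := Fact.out
  have hroot : ∀ {E : Type _} [Field E] [Algebra k E] [CharP E p] (σ : E →ₐ[k] E) (x : E) (b : k),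
      x ^ p - x = algebraMap k E b → ∃ c : ZMod p, ZMod.castHom dvd_rfl E c = σ x - x := by
    intro E _ _ _ σ x b hx
    apply ArtinSchreier.exists_cast_eq_of_pow_eq_self
    have := congrArg σ hx
    rw [AlgHom.commutes, ← hx, map_sub, map_pow] at this
    rw [sub_pow_char]
    linear_combination this
  have hnormal : Normal k (adjoin k (Set.range α)) := by
    rw [normal_iff_forall_map_le]
    intro σ
    rw [adjoin_map, adjoin_le_iff]
    rintro _ ⟨_, ⟨i, rfl⟩, rfl⟩
    obtain ⟨c, hc⟩ := hroot σ (α i) (a i) (hα i)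
    have : σ (α i) = α i + algebraMap k Ω (ZMod.castHom dvd_rfl k c) := by
      rw [← sub_eq_iff_eq_add', ← hc, ← RingHom.comp_apply]
      congr 1
      exact Subsingleton.elim _ _
    simp only [SetLike.mem_coe]
    rw [this]
    exact add_mem (subset_adjoin _ _ ⟨i, rfl⟩) (IntermediateField.algebraMap_mem _ _)
  have hsep : Algebra.IsSeparable k (adjoin k (Set.range α)) := by
    rw [isSeparable_adjoin_iff_isSeparable]
    rintro _ ⟨i, rfl⟩
    exact ArtinSchreier.isSeparable (hα i)
  have hgal : IsGalois k (adjoin k (Set.range α)) := ⟨⟩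
  have hfin : FiniteDimensional k (adjoin k (Set.range α)) :=
    finiteDimensional_adjoin fun x _ => Algebra.IsIntegral.isIntegral x
  let γ : ι → adjoin k (Set.range α) := fun i => ⟨α i, subset_adjoin _ _ ⟨i, rfl⟩⟩
  have hγ : ∀ i, γ i ^ p - γ i = algebraMap k _ (a i) := fun i => Subtype.ext (hα i)
  choose φ hφ using fun (σ : Gal(adjoin k (Set.range α)/k)) i =>
    hroot σ.toAlgHom (γ i) (a i) (hγ i)
  let ι' := ZMod.castHom (dvd_refl p) (adjoin k (Set.range α))
  have hcomp : ∀ c : ZMod p, ι' c = algebraMap k _ (ZMod.castHom dvd_rfl k c) := fun c => by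
    rw [← RingHom.comp_apply]
    congr 1
    exact Subsingleton.elim _ _
  have hφ' : ∀ σ i, σ (γ i) = γ i + ι' (φ σ i) := fun σ i => by
    simp only [ι', hφ]
    simp
  have hinj : Function.Injective φ := by
    intro σ τ h
    have : σ.toAlgHom = τ.toAlgHom := by
      apply IntermediateField.algHom_ext_of_eq_adjoin _ rfl
      rintro _ ⟨i, rfl⟩
      change σ (γ i) = τ (γ i)
      rw [hφ', hφ', h]
    exact AlgEquiv.ext fun x => DFunLike.congr_fun this x
  let Φ : Additive Gal(adjoin k (Set.range α)/k) →+ (ι → ZMod p) :=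
    AddMonoidHom.mk' (fun σ => φ σ.toMul) fun σ τ => by
      ext i
      apply ι'.injective
      have h : (σ + τ).toMul (γ i) = σ.toMul (τ.toMul (γ i)) := rfl
      have hι : ∀ σ : Gal(adjoin k (Set.range α)/k), ∀ c, σ (ι' c) = ι' c := fun σ c => by
        rw [hcomp, AlgEquiv.commutes]
      rw [hφ' (σ + τ).toMul, hφ' τ.toMul, map_add σ.toMul, hφ' σ.toMul, hι] at h
      simp only [Pi.add_apply, map_add]
      linear_combination h
  have hsurj : AddSubgroup.toZModSubmodule p Φ.range = ⊤ := by
    by_contra hne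
    obtain ⟨f, hf0, hf⟩ := Submodule.exists_le_ker_of_lt_top _ (lt_top_iff_ne_top.2 hne)
    let c : ι → ZMod p := fun i => f (Pi.single i 1)
    have hfc : ∀ v, f v = ∑ i, c i * v i := fun v => by
      rw [LinearMap.pi_apply_eq_sum_univ f v]
      simp only [smul_eq_mul, c, mul_comm]
      refine Finset.sum_congr rfl fun i _ => ?_
      congr 2
      ext j
      simp [Pi.single_apply, eq_comm]
    have hfix : ∀ σ : Gal(adjoin k (Set.range α)/k),
        σ (∑ i, ι' (c i) * γ i) = ∑ i, ι' (c i) * γ i := fun σ => by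
      have h0 : f (φ σ) = 0 := hf ⟨Additive.ofMul σ, rfl⟩
      rw [hfc] at h0
      have h1 := congrArg ι' h0
      simp only [map_sum, map_mul, map_zero] at h1 ⊢
      simp only [hφ', mul_add, Finset.sum_add_distrib]
      simp only [hcomp, AlgEquiv.commutes] at h1 ⊢
      rw [h1, add_zero]
    obtain ⟨y, hy⟩ := (IsGalois.mem_range_algebraMap_iff_fixed _).2 hfix
    have hc := ha c y ?_
    · apply hf0
      ext i
      simpa [c] using congrFun hc i
    · apply (algebraMap k (adjoin k (Set.range α))).injective
      have hpow : ∀ c, ι' c ^ p = ι' c := fun c => by rw [← map_pow, ZMod.pow_card]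
      rw [map_sub, map_pow, hy, sum_pow_char, ← Finset.sum_sub_distrib, map_sum]
      refine Finset.sum_congr rfl fun i _ => ?_
      rw [mul_pow, hpow, map_mul, ← hcomp, ← hγ]
      ring
  have hbij : Function.Bijective φ := by
    refine ⟨hinj, fun v => ?_⟩
    have : v ∈ AddSubgroup.toZModSubmodule p Φ.range := hsurj ▸ Submodule.mem_top
    obtain ⟨σ, hσ⟩ := this
    exact ⟨σ.toMul, hσ⟩
  rw [← IsGalois.card_aut_eq_finrank, Nat.card_congr (Equiv.ofBijective φ hbij)]
  simp

open WithZero in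
theorem Valuation.dvd_of_map_pow_sub_self_eq_exp {K : Type*} [Field K] (v : Valuation K ℤᵐ⁰)
    {p e : ℕ} (hp : 1 < p) (he : e ≠ 0) {y : K} (h : v (y ^ p - y) = exp (e : ℤ)) : p ∣ e := by
  have h1 : 1 < v y := by
    by_contra! hy
    have hle : v (y ^ p - y) ≤ 1 :=
      (v.map_sub _ _).trans (max_le (by rw [map_pow]; exact pow_le_one₀ zero_le hy) hy)
    rw [h, ← exp_zero, exp_le_exp] at hle
    omega
  have hlt : v y < v (y ^ p) := by
    rw [map_pow]
    exact lt_self_pow₀ h1 hp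
  rw [v.map_sub_eq_of_lt_left hlt, map_pow, ← exp_log (ne_of_gt (zero_lt_one.trans h1)),
    ← exp_nsmul, exp_inj] at h
  refine Int.natCast_dvd_natCast.1 ⟨log (v y), ?_⟩
  rw [← h, nsmul_eq_mul]

open Polynomial WithZero IsDedekindDomain in
theorem ArtinSchreier.eq_zero_of_pow_sub_self_eq_sum {F K ι : Type*} [Field F] [Field K]
    [Algebra F[X] K] [IsFractionRing F[X] K] [Fintype ι] {p : ℕ} [Fact p.Prime] [CharP F p] [CharP K p]
    {P Q : ι → F[X]} {e : ι → ℕ}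
    (hPmonic : ∀ i, (P i).Monic) (hPirr : ∀ i, Irreducible (P i)) (hPinj : Function.Injective P)
    (hcop : ∀ i, IsCoprime (P i) (Q i)) (he : ∀ i, ¬ p ∣ e i)
    (c : ι → ZMod p) (b : F[X]) (y : K)
    (h : y ^ p - y = algebraMap F[X] K b + ∑ i, ZMod.castHom dvd_rfl K (c i) *
      (algebraMap F[X] K (Q i) / algebraMap F[X] K (P i) ^ e i)) : c = 0 := by
  classical
  have hp : p.Prime := Fact.out
  have hcast : ∀ a : ZMod p, ZMod.castHom dvd_rfl K a =
      algebraMap F[X] K (ZMod.castHom dvd_rfl F[X] a) := fun a => by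
    rw [← RingHom.comp_apply]
    congr 1
    exact Subsingleton.elim _ _
  ext j
  by_contra hj
  simp only [Pi.zero_apply] at hj
  let w : HeightOneSpectrum F[X] :=
    { asIdeal := Ideal.span {P j}
      isPrime := (Ideal.span_singleton_prime (hPirr j).ne_zero).2 (hPirr j).prime
      ne_bot := by simpa using (hPirr j).ne_zero }
  have hw : ∀ r : F[X], ¬ P j ∣ r → w.valuation K (algebraMap F[X] K r) = 1 := fun r hr => by
    rw [HeightOneSpectrum.valuation_eq_one_iff_notMem]
    rwa [Ideal.mem_span_singleton]
  have hP : w.valuation K (algebraMap F[X] K (P j)) = exp (-1 : ℤ) := by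
    rw [HeightOneSpectrum.valuation_of_algebraMap,
      HeightOneSpectrum.intValuation_singleton _ (hPirr j).ne_zero rfl]
  have hej : e j ≠ 0 := fun h0 => he j (h0 ▸ dvd_zero p)
  have hvj : w.valuation K (ZMod.castHom dvd_rfl K (c j) *
      (algebraMap F[X] K (Q j) / algebraMap F[X] K (P j) ^ e j)) = exp (e j : ℤ) := by
    rw [map_mul, map_div₀, map_pow, hP, hcast, hw, hw, one_mul, one_div, ← exp_nsmul, ← exp_neg]
    · simp
    · exact fun hd => (hPirr j).not_isUnit ((hcop j).isUnit_of_dvd' dvd_rfl hd)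
    · exact fun hd => (hPirr j).not_isUnit
        (isUnit_of_dvd_unit hd ((isUnit_iff_ne_zero.2 hj).map (ZMod.castHom dvd_rfl F[X])))
  have hlt : 1 < exp (e j : ℤ) := by
    rw [← exp_zero, exp_lt_exp]
    omega
  refine he j (Valuation.dvd_of_map_pow_sub_self_eq_exp (w.valuation K) hp.one_lt hej (y := y) ?_)
  rw [h, ← Finset.add_sum_erase _ _ (Finset.mem_univ j), add_left_comm, ← hvj]
  refine Valuation.map_add_eq_of_lt_left _ (lt_of_le_of_lt ?_ (hvj ▸ hlt))
  refine Valuation.map_add_le _ (w.valuation_le_one b) (Valuation.map_sum_le _ fun i hi => ?_)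
  rw [map_mul, map_div₀, map_pow, hw (P i), one_pow, div_one, hcast]
  · exact mul_le_one' (w.valuation_le_one _) (w.valuation_le_one _)
  · intro hd
    exact Finset.ne_of_mem_erase hi (hPinj (eq_of_monic_of_associated (hPmonic j) (hPmonic i)
      ((hPirr j).associated_of_dvd (hPirr i) hd))).symm

open Polynomial in
theorem ArtinSchreier.eq_zero_of_pow_sub_self_eq_mul {F K : Type*} [Field F] [Field K]
    [Algebra F[X] K] [IsFractionRing F[X] K] {p : ℕ} [Fact p.Prime] [CharP F p] {f : F[X]}
    (hf : ((¬ ∃ c : F, f = C c) ∧ ¬ p ∣ f.natDegree) ∨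
      (∃ c : F, f = C c ∧ ¬ ∃ x : F, x ^ p - x = c))
    (c : ZMod p) (y : K)
    (h : y ^ p - y = algebraMap F[X] K (ZMod.castHom dvd_rfl F[X] c * f)) : c = 0 := by
  have hp : p.Prime := Fact.out
  by_contra hc
  have hcast : ZMod.castHom dvd_rfl F[X] c = C (ZMod.castHom dvd_rfl F c) := by
    rw [← RingHom.comp_apply]
    congr 1
    exact Subsingleton.elim _ _
  have hc' : ZMod.castHom dvd_rfl F c ≠ 0 := (_root_.map_ne_zero _).2 hc
  have hy : IsIntegral F[X] y := by
    refine ⟨X ^ p - (X + C (ZMod.castHom dvd_rfl F[X] c * f)), monic_X_pow_sub ?_, ?_⟩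
    · refine (degree_X_add_C _).trans_lt ?_
      exact_mod_cast hp.one_lt
    · rw [eval₂_sub, eval₂_X_pow, eval₂_add, eval₂_X, eval₂_C, ← h]
      ring
  obtain ⟨g, rfl⟩ := IsIntegrallyClosed.isIntegral_iff.1 hy
  rw [← map_pow, ← map_sub, (IsFractionRing.injective F[X] K).eq_iff, hcast] at h
  have hdeg : f.natDegree = p * g.natDegree := by
    rw [← natDegree_C_mul hc', ← h]
    by_cases hg : g.natDegree = 0
    · rw [eq_C_of_natDegree_eq_zero hg, ← C_pow, ← C_sub]
      simp
    · rw [natDegree_sub_eq_left_of_natDegree_lt, natDegree_pow]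
      rw [natDegree_pow]
      exact lt_mul_of_one_lt_left (Nat.pos_of_ne_zero hg) hp.one_lt
  rcases hf with ⟨-, hf⟩ | ⟨a, rfl, ha⟩
  · exact hf ⟨_, hdeg⟩
  · have hg : g.natDegree = 0 := by simpa [hp.ne_zero] using hdeg.symm
    rw [eq_C_of_natDegree_eq_zero hg, ← C_pow, ← C_sub, ← C_mul, C_inj] at h
    refine ha ⟨ZMod.castHom dvd_rfl F c⁻¹ * g.coeff 0, ?_⟩
    rw [mul_pow, ← map_pow, ZMod.pow_card, ← mul_sub, h, ← mul_assoc, ← map_mul,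
      inv_mul_cancel₀ hc, map_one, one_mul]

/-- The Artin-Schreier extensions `k(α_1), …, k(α_m), k(β)` of `k = F_q(t)`
(with `α_i^p - α_i = Q_i/P_i^{e_i}`, `β^p - β = f`, in normalized form with the
`P_i` distinct and `f` nonconstant or a constant not of the form `x^p - x`) are
linearly disjoint over `k`; consequently each has degree `p` over `k` and
`[k(α_1, …, α_m, β) : k] = p^(m+1)`. -/
theorem compositum_degree_p_pow_succ
    (p m : ℕ) (hp : p.Prime)
    (Fq : Type*) [Field Fq] [Fintype Fq] [CharP Fq p]
    (Ω : Type*) [Field Ω] [Algebra (RatFunc Fq) Ω]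
    [Algebra (Polynomial Fq) Ω] [IsScalarTower (Polynomial Fq) (RatFunc Fq) Ω]
    [IsAlgClosure (RatFunc Fq) Ω]
    (P Q : Fin m → Polynomial Fq) (e : Fin m → ℕ) (f : Polynomial Fq)
    (hPmonic : ∀ i, (P i).Monic) (hPirr : ∀ i, Irreducible (P i))
    (hPinj : Function.Injective P)
    (hcop : ∀ i, IsCoprime (P i) (Q i)) (he : ∀ i, ¬ p ∣ e i)
    (hdeg : ∀ i, (Q i).degree < ((P i) ^ (e i)).degree)
    -- `f` is nonconstant (with degree prime to `p`) or a constant not of the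
    -- form `x^p - x`
    (hf : ((¬ ∃ c : Fq, f = Polynomial.C c) ∧ ¬ p ∣ f.natDegree) ∨
      (∃ c : Fq, f = Polynomial.C c ∧ ¬ ∃ x : Fq, x ^ p - x = c))
    (β : Ω) (αi : Fin m → Ω)
    (hαi : ∀ i, (αi i) ^ p - αi i = algebraMap (RatFunc Fq) Ω
      (algebraMap (Polynomial Fq) (RatFunc Fq) (Q i) /
        (algebraMap (Polynomial Fq) (RatFunc Fq) (P i)) ^ (e i)))
    (hβ : β ^ p - β = algebraMap (RatFunc Fq) Ω
      (algebraMap (Polynomial Fq) (RatFunc Fq) f)) :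
    (∀ i, Module.finrank (RatFunc Fq)
      (IntermediateField.adjoin (RatFunc Fq) {αi i}) = p) ∧
    Module.finrank (RatFunc Fq) (IntermediateField.adjoin (RatFunc Fq) {β}) = p ∧
    Module.finrank (RatFunc Fq)
      (IntermediateField.adjoin (RatFunc Fq) (insert β (Set.range αi))) =
        p ^ (m + 1) := by
  have : Fact p.Prime := ⟨hp⟩
  have : CharP (RatFunc Fq) p :=
    charP_of_injective_algebraMap (algebraMap Fq (RatFunc Fq)).injective p
  have : Normal (RatFunc Fq) Ω := IsAlgClosure.normal _ _
  have hcast : ∀ a : ZMod p, ZMod.castHom dvd_rfl (RatFunc Fq) a =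
      algebraMap (Polynomial Fq) (RatFunc Fq) (ZMod.castHom dvd_rfl (Polynomial Fq) a) := by
    intro a
    rw [← RingHom.comp_apply]
    congr 1
    exact Subsingleton.elim _ _
  refine ⟨fun i => ?_, ?_, ?_⟩
  · rw [← Set.range_const (ι := Unit), ArtinSchreier.finrank_adjoin_range _ _ fun _ => hαi i]
    · simp
    · intro c y h
      refine ArtinSchreier.eq_zero_of_pow_sub_self_eq_sum (fun _ : Unit => hPmonic i)
        (fun _ => hPirr i) (fun _ _ _ => rfl) (fun _ => hcop i) (fun _ => he i) c 0 y ?_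
      rw [h, map_zero, zero_add]
  · rw [← Set.range_const (ι := Unit), ArtinSchreier.finrank_adjoin_range _ _ fun _ => hβ]
    · simp
    · intro c y h
      ext
      refine ArtinSchreier.eq_zero_of_pow_sub_self_eq_mul hf (c ()) y ?_
      rw [h, Fintype.sum_unique, hcast, ← map_mul]
  · have hrange : insert β (Set.range αi) = Set.range fun o : Option (Fin m) => o.elim β αi := by
      ext x
      simp [Option.exists, eq_comm]
    rw [hrange, ArtinSchreier.finrank_adjoin_range
      (fun o : Option (Fin m) => o.elim (algebraMap (Polynomial Fq) (RatFunc Fq) f) fun i =>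
        algebraMap (Polynomial Fq) (RatFunc Fq) (Q i) /
          (algebraMap (Polynomial Fq) (RatFunc Fq) (P i)) ^ (e i)) _
      (by rintro (_ | i); exacts [hβ, hαi i])]
    · simp
    · intro c y h
      rw [Fintype.sum_option] at h
      simp only [Option.elim] at h
      rw [hcast, ← map_mul] at h
      have hsome := ArtinSchreier.eq_zero_of_pow_sub_self_eq_sum hPmonic hPirr hPinj hcop he
        (fun i => c (some i)) _ y h
      have hnone := ArtinSchreier.eq_zero_of_pow_sub_self_eq_mul hf (c none) y (by
        rw [h, Finset.sum_eq_zero fun i _ => ?_, add_zero]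
        rw [show c (some i) = 0 from congrFun hsome i, map_zero, zero_mul])
      ext (_ | i)
      exacts [hnone, congrFun hsome i]
end
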